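/- arXiv:2312.13167 — 3 statements merged into one kernel-verified Lean document; each statement's English description precedes it below -/
import Mathlib

section
/- Let Ω be a Polish space, p : Ω → [0,∞) a Borel function, and 𝒢 a set of Borel functions g : Ω → ℝ with ‖g‖ := sup_ω |g(ω)|/(p(ω)+1) finite. Let μ and ν be Borel probability measures on Ω with ∫ p dμ < ∞ and ∫ p dν < ∞, and let δ > 0. Assume there exists a coupling π₀ of (μ, ν) such that for every g ∈ 𝒢 and every bounded nonnegative Borel measurable h one has ∫ h(ω₁) g(ω₁) dμ ≤ ∫ h(ω₁) g(ω₂) dπ₀. Then for every Borel set U ⊆ Ω × Ω the following are equivalent: (i) π(U) = 0 for every coupling π of (μ, ν) satisfying, for all g ∈ 𝒢 and all bounded nonnegative Borel h, ∫ h(ω₁) g(ω₁) dμ − ∫ h(ω₁) g(ω₂) dπ ≤ δ·(sup h)·‖g‖; (ii) there exist Borel sets N₁, N₂ ⊆ Ω with μ(N₁) = 0, ν(N₂) = 0 and U ⊆ (N₁ × Ω) ∪ (Ω × N₂). -/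
open MeasureTheory

/-- The weighted sup-norm `‖g‖ = sup_ω |g(ω)|/(p(ω)+1)`. -/
noncomputable def pNorm {Ω : Type*} (p : Ω → ℝ) (g : Ω → ℝ) : ℝ :=
  ⨆ ω : Ω, |g ω| / (p ω + 1)

section NullSets

open Set Filter Topology

lemma exists_mem_iInter_norm_le {F : Type*} [NormedAddCommGroup F] [InnerProductSpace ℝ F]
    [CompleteSpace F] {C : ℕ → Set F} (hcl : ∀ n, IsClosed (C n)) (hco : ∀ n, Convex ℝ (C n))
    (hanti : Antitone C) {r : ℝ} (hr : ∀ n, ∃ v ∈ C n, ‖v‖ ≤ r) :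
    ∃ v ∈ ⋂ n, C n, ‖v‖ ≤ r := by
  have hmin : ∀ n, ∃ v ∈ C n, ∀ w ∈ C n, ‖v‖ ^ 2 + ‖w - v‖ ^ 2 ≤ ‖w‖ ^ 2 := by
    intro n
    obtain ⟨v, hv, hve⟩ := exists_norm_eq_iInf_of_complete_convex
      (let ⟨v, hv, _⟩ := hr n; ⟨v, hv⟩) (hcl n).isComplete (hco n) 0
    refine ⟨v, hv, fun w hw => ?_⟩
    have h := (norm_eq_iInf_iff_real_inner_le_zero (hco n) hv).1 hve w hw
    have h2 := norm_add_sq_real v (w - v)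
    rw [add_sub_cancel] at h2
    rw [zero_sub, inner_neg_left] at h
    linarith
  choose v hv hvmin using hmin
  have hle : ∀ n m, n ≤ m → ‖v n‖ ^ 2 + ‖v m - v n‖ ^ 2 ≤ ‖v m‖ ^ 2 :=
    fun n m hnm => hvmin n _ (hanti hnm (hv m))
  have hvr : ∀ n, ‖v n‖ ≤ r := by
    intro n
    obtain ⟨w, hw, hwr⟩ := hr n
    refine le_trans ?_ hwr
    have := hvmin n w hw
    exact abs_le_of_sq_le_sq' (by nlinarith [sq_nonneg ‖w - v n‖]) (norm_nonneg _) |>.2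
  have hmono : Monotone fun n => ‖v n‖ ^ 2 := fun n m hnm => by
    have := hle n m hnm
    dsimp only
    nlinarith [sq_nonneg ‖v m - v n‖]
  have hbdd : BddAbove (range fun n => ‖v n‖ ^ 2) :=
    ⟨r ^ 2, by rintro _ ⟨n, rfl⟩; exact pow_le_pow_left₀ (norm_nonneg _) (hvr n) 2⟩
  have hcs := (tendsto_atTop_ciSup hmono hbdd).cauchySeq
  have hvc : CauchySeq v := by
    rw [Metric.cauchySeq_iff'] at hcs ⊢
    intro ε hε
    obtain ⟨N, hN⟩ := hcs (ε ^ 2) (by positivity)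
    refine ⟨N, fun n hn => ?_⟩
    have h1 := hN n hn
    have h2 := hle N n hn
    rw [Real.dist_eq] at h1
    rw [dist_eq_norm]
    exact lt_of_pow_lt_pow_left₀ 2 hε.le (by linarith [le_abs_self (‖v n‖ ^ 2 - ‖v N‖ ^ 2)])
  obtain ⟨x, hx⟩ := cauchySeq_tendsto_of_complete hvc
  refine ⟨x, mem_iInter.2 fun n => (hcl n).mem_of_tendsto hx ?_, le_of_tendsto' hx.norm hvr⟩
  filter_upwards [eventually_ge_atTop n] with m hm using hanti hm (hv m)

lemma measure_le_of_forall_integral_le {X : Type*} [MeasurableSpace X] [TopologicalSpace X]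
    [TopologicalSpace.PseudoMetrizableSpace X] [BorelSpace X] {μ ν : Measure X}
    [IsFiniteMeasure μ] [IsFiniteMeasure ν]
    (h : ∀ f : BoundedContinuousFunction X ℝ, 0 ≤ f → ∫ x, f x ∂μ ≤ ∫ x, f x ∂ν) : μ ≤ ν := by
  have hF : ∀ F : Set X, IsClosed F → μ F ≤ ν F := by
    intro F hF
    refine le_of_tendsto_of_tendsto' (HasOuterApproxClosed.tendsto_lintegral_apprSeq hF μ)
      (HasOuterApproxClosed.tendsto_lintegral_apprSeq hF ν) fun n => ?_
    rw [← ENNReal.toReal_le_toReal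
      (BoundedContinuousFunction.lintegral_lt_top_of_nnreal μ _).ne
      (BoundedContinuousFunction.lintegral_lt_top_of_nnreal ν _).ne,
      BoundedContinuousFunction.toReal_lintegral_coe_eq_integral,
      BoundedContinuousFunction.toReal_lintegral_coe_eq_integral]
    exact h ⟨⟨fun x => (hF.apprSeq n x : ℝ),
      NNReal.continuous_coe.comp (hF.apprSeq n).continuous⟩, (hF.apprSeq n).map_bounded'⟩
      fun x => NNReal.coe_nonneg _
  refine Measure.le_iff.2 fun A hA => ?_
  rw [hA.measure_eq_iSup_isClosed_of_ne_top (measure_ne_top μ A)]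
  exact iSup₂_le fun K hK => iSup_le fun hKc => (hF K hKc).trans (measure_mono hK)

theorem choquet_capacitability {α : Type*} [TopologicalSpace α] {P : Set α → Prop}
    (hmono : ∀ s t, s ⊆ t → P t → P s)
    (hiUnion : ∀ s : ℕ → Set α, Monotone s → (∀ n, P (s n)) → P (⋃ n, s n))
    {U : Set α} (hU : AnalyticSet U)
    (hcompact : ∀ K ⊆ U, IsCompact K → ∃ V, IsOpen V ∧ K ⊆ V ∧ P V) : P U := by
  rw [AnalyticSet] at hU
  rcases hU with rfl | ⟨f, hf, rfl⟩
  · obtain ⟨V, -, -, hV⟩ := hcompact ∅ subset_rfl isCompact_empty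
    exact hmono _ _ (empty_subset V) hV
  by_contra hP
  have hstep : ∀ (k : ℕ) (T : Set (ℕ → ℕ)), ∃ n, ¬ P (f '' T) → ¬ P (f '' (T ∩ {σ | σ k ≤ n})) := by
    intro k T
    by_contra! h
    refine (h 0).1 ?_
    have := hiUnion (fun n => f '' (T ∩ {σ | σ k ≤ n}))
      (fun n m hnm => image_mono (inter_subset_inter_right _ fun σ hσ => le_trans hσ hnm))
      (fun n => (h n).2)
    refine hmono _ _ ?_ this
    rintro _ ⟨σ, hσ, rfl⟩
    exact mem_iUnion.2 ⟨σ k, σ, ⟨hσ, le_refl (σ k)⟩, rfl⟩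
  choose N hN using hstep
  let T : ℕ → Set (ℕ → ℕ) := fun k => Nat.rec univ (fun k T => T ∩ {σ | σ k ≤ N k T}) k
  let g : ℕ → ℕ := fun k => N k (T k)
  have hTP : ∀ k, ¬ P (f '' T k) := by
    intro k
    induction k with
    | zero => simpa [T] using hP
    | succ k ih => exact hN k _ ih
  have hT : ∀ k, ∀ σ ∈ T k, ∀ i < k, σ i ≤ g i := by
    intro k
    induction k with
    | zero => simp
    | succ k ih =>
      rintro σ ⟨h1, h2⟩ i hi
      rcases Nat.lt_succ_iff_lt_or_eq.1 hi with h | rfl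
      exacts [ih σ h1 i h, h2]
  have hC : IsCompact (Set.pi univ fun i => Iic (g i)) :=
    isCompact_univ_pi fun i => (finite_Iic (g i)).isCompact
  obtain ⟨V, hVo, hVK, hV⟩ := hcompact _ (image_subset_range f _) (hC.image hf)
  have hex : ∀ k, ∃ σ ∈ T k, f σ ∉ V := by
    intro k
    by_contra! h
    exact hTP k (hmono _ _ (image_subset_iff.2 h) hV)
  choose σ hσT hσV using hex
  obtain ⟨τ, hτ, φ, hφ, hlim⟩ := hC.tendsto_subseq
    (x := fun k i => min (σ k i) (g i)) fun k i _ => mem_Iic.2 (min_le_right _ _)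
  have hlim' : Tendsto (fun k => σ (φ k)) atTop (𝓝 τ) := by
    rw [tendsto_pi_nhds] at hlim ⊢
    intro i
    refine (hlim i).congr' ?_
    filter_upwards [eventually_gt_atTop i] with k hk
    exact min_eq_left (hT _ _ (hσT _) i (hk.trans_le (hφ.id_le k)))
  have hτV : f τ ∈ V := hVK (mem_image_of_mem f hτ)
  obtain ⟨k, hk⟩ := ((hf.tendsto τ).comp hlim' |>.eventually (hVo.mem_nhds hτV)).exists
  exact hσV _ hk

/-- The square-integrable functions on the disjoint union that cover `U` up to marginally null
sets: `1 ≤ f x + f y` for almost all `(x, y) ∈ U`. -/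
def marginalCover {α β : Type*} [MeasurableSpace α] [MeasurableSpace β]
    (lam : Measure (α ⊕ β)) (U : Set (α × β)) : Set (Lp ℝ 2 lam) :=
  {f | ∃ N, lam N = 0 ∧ ∀ x y, (x, y) ∈ U → Sum.inl x ∉ N → Sum.inr y ∉ N →
    1 ≤ f (Sum.inl x) + f (Sum.inr y)}

section marginalCover

variable {α β : Type*} [MeasurableSpace α] [MeasurableSpace β] {lam : Measure (α ⊕ β)}

lemma marginalCover_anti {U V : Set (α × β)} (h : U ⊆ V) :
    marginalCover lam V ⊆ marginalCover lam U :=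
  fun _ ⟨N, hN, hf⟩ => ⟨N, hN, fun x y hxy => hf x y (h hxy)⟩

lemma iInter_marginalCover_subset (U : ℕ → Set (α × β)) :
    ⋂ n, marginalCover lam (U n) ⊆ marginalCover lam (⋃ n, U n) := by
  intro f hf
  choose N hN hNf using mem_iInter.1 hf
  refine ⟨⋃ n, N n, measure_iUnion_null hN, fun x y hxy hx hy => ?_⟩
  obtain ⟨n, hn⟩ := mem_iUnion.1 hxy
  exact hNf n x y hn (fun h => hx (mem_iUnion.2 ⟨n, h⟩)) fun h => hy (mem_iUnion.2 ⟨n, h⟩)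

lemma convex_marginalCover (U : Set (α × β)) : Convex ℝ (marginalCover lam U) := by
  rintro f ⟨N, hN, hf⟩ g ⟨M, hM, hg⟩ a b ha hb hab
  have hae : ∀ᵐ z ∂lam, (a • f + b • g : Lp ℝ 2 lam) z = a * f z + b * g z := by
    filter_upwards [Lp.coeFn_add (a • f) (b • g), Lp.coeFn_smul a f, Lp.coeFn_smul b g]
      with z h1 h2 h3
    rw [h1, Pi.add_apply, h2, h3]
    rfl
  refine ⟨N ∪ M ∪ {z | ¬ (a • f + b • g : Lp ℝ 2 lam) z = a * f z + b * g z},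
    measure_union_null (measure_union_null hN hM) hae, fun x y hxy hx hy => ?_⟩
  simp only [mem_union, mem_ofPred_eq, not_or, not_not] at hx hy
  rw [hx.2, hy.2]
  have h1 := hf x y hxy hx.1.1 hy.1.1
  have h2 := hg x y hxy hx.1.2 hy.1.2
  nlinarith

lemma isClosed_marginalCover (U : Set (α × β)) : IsClosed (marginalCover lam U) := by
  refine IsSeqClosed.isClosed fun F f hF hlim => ?_
  choose N hN hNf using hF
  obtain ⟨φ, -, hφ⟩ := (tendstoInMeasure_of_tendsto_Lp hlim).exists_seq_tendsto_ae
  refine ⟨(⋃ n, N n) ∪ {z | ¬ Tendsto (fun i => F (φ i) z) atTop (𝓝 (f z))},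
    measure_union_null (measure_iUnion_null hN) hφ, fun x y hxy hx hy => ?_⟩
  simp only [mem_union, mem_ofPred_eq, not_or, not_not, mem_iUnion, not_exists] at hx hy
  exact ge_of_tendsto' (hx.2.add hy.2) fun i => hNf _ x y hxy (hx.1 _) (hy.1 _)

lemma exists_mem_marginalCover_of_subset {U : Set (α × β)} {A : Set (α ⊕ β)}
    (hA : MeasurableSet A) {r : ℝ} (hr : 0 ≤ r) (hAr : lam A ≤ ENNReal.ofReal (r ^ 2))
    (hU : ∀ x y, (x, y) ∈ U → Sum.inl x ∈ A ∨ Sum.inr y ∈ A) :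
    ∃ f ∈ marginalCover lam U, ‖f‖ ≤ r := by
  have hAtop : lam A ≠ ⊤ := (hAr.trans_lt ENNReal.ofReal_lt_top).ne
  refine ⟨indicatorConstLp 2 hA hAtop (1 : ℝ), ?_, ?_⟩
  · refine ⟨{z | ¬ indicatorConstLp 2 hA hAtop (1 : ℝ) z = A.indicator (fun _ => (1 : ℝ)) z},
      indicatorConstLp_coeFn, fun x y hxy hx hy => ?_⟩
    simp only [mem_ofPred_eq, not_not] at hx hy
    rw [hx, hy]
    have h0 : ∀ z, 0 ≤ A.indicator (fun _ => (1 : ℝ)) z :=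
      indicator_nonneg fun _ _ => zero_le_one
    rcases hU x y hxy with h | h
    · rw [indicator_of_mem h]
      linarith [h0 (Sum.inr y)]
    · rw [indicator_of_mem h]
      linarith [h0 (Sum.inl x)]
  · rw [norm_indicatorConstLp (by norm_num) (by norm_num), norm_one, one_mul]
    have h1 : lam.real A ≤ r ^ 2 := ENNReal.toReal_le_of_le_ofReal (by positivity) hAr
    calc lam.real A ^ (1 / (2 : ENNReal).toReal) ≤ (r ^ 2) ^ (1 / (2 : ENNReal).toReal) := by
          gcongr
      _ = r := by
          rw [ENNReal.toReal_ofNat, ← Real.sqrt_eq_rpow, Real.sqrt_sq hr]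

lemma exists_null_of_zero_mem_marginalCover {U : Set (α × β)} (h : 0 ∈ marginalCover lam U) :
    ∃ N, MeasurableSet N ∧ lam N = 0 ∧ ∀ x y, (x, y) ∈ U → Sum.inl x ∈ N ∨ Sum.inr y ∈ N := by
  obtain ⟨N, hN, hNU⟩ := h
  refine ⟨toMeasurable lam (N ∪ {z | ¬ (0 : Lp ℝ 2 lam) z = 0}), measurableSet_toMeasurable _ _,
    ?_, fun x y hxy => ?_⟩
  · rw [measure_toMeasurable]
    exact measure_union_null hN (Lp.coeFn_zero ℝ 2 lam)
  · by_contra! hc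
    have hx := notMem_subset (subset_toMeasurable _ _) hc.1
    have hy := notMem_subset (subset_toMeasurable _ _) hc.2
    simp only [mem_union, mem_ofPred_eq, not_or, not_not] at hx hy
    have := hNU x y hxy hx.1 hy.1
    rw [hx.2, hy.2] at this
    norm_num at this

end marginalCover

lemma exists_coupling_ge {α β : Type*} [MeasurableSpace α] [MeasurableSpace β]
    {μ : Measure α} {ν : Measure β} [IsProbabilityMeasure μ] [IsProbabilityMeasure ν]
    {θ : Measure (α × β)} (hθ : θ univ < 1) (h₁ : θ.map Prod.fst ≤ μ) (h₂ : θ.map Prod.snd ≤ ν) :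
    ∃ π : Measure (α × β), IsProbabilityMeasure π ∧ π.map Prod.fst = μ ∧ π.map Prod.snd = ν ∧
      θ ≤ π := by
  have : IsFiniteMeasure θ := ⟨hθ.trans ENNReal.one_lt_top⟩
  have hu₁ : (μ - θ.map Prod.fst) univ = 1 - θ univ := by
    rw [Measure.sub_apply .univ h₁, Measure.map_apply measurable_fst .univ, measure_univ,
      preimage_univ]
  have hu₂ : (ν - θ.map Prod.snd) univ = 1 - θ univ := by
    rw [Measure.sub_apply .univ h₂, Measure.map_apply measurable_snd .univ, measure_univ,
      preimage_univ]
  have hc : (1 - θ univ)⁻¹ * (1 - θ univ) = 1 :=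
    ENNReal.inv_mul_cancel (tsub_pos_of_lt hθ).ne' (by finiteness)
  set π := θ + (1 - θ univ)⁻¹ • (μ - θ.map Prod.fst).prod (ν - θ.map Prod.snd)
  have hπ₁ : π.map Prod.fst = μ := by
    rw [Measure.map_add _ _ measurable_fst, Measure.map_smul, Measure.map_fst_prod, hu₂, smul_smul,
      hc, one_smul, add_comm, Measure.sub_add_cancel_of_le h₁]
  have hπ₂ : π.map Prod.snd = ν := by
    rw [Measure.map_add _ _ measurable_snd, Measure.map_smul, Measure.map_snd_prod, hu₁, smul_smul,
      hc, one_smul, add_comm, Measure.sub_add_cancel_of_le h₂]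
  refine ⟨π, ⟨?_⟩, hπ₁, hπ₂, Measure.le_add_right le_rfl⟩
  rw [← preimage_univ (f := Prod.fst), ← Measure.map_apply measurable_fst .univ, hπ₁, measure_univ]

lemma exists_measure_of_isCompact {α β : Type*} [TopologicalSpace α] [PolishSpace α]
    [MeasurableSpace α] [BorelSpace α] [TopologicalSpace β] [PolishSpace β]
    [MeasurableSpace β] [BorelSpace β] {μ : Measure α} {ν : Measure β} [IsFiniteMeasure μ]
    [IsFiniteMeasure ν] {K : Set (α × β)} (hK : IsCompact K) {ε : ℝ} (hε : 0 < ε)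
    (h : ∀ (a : BoundedContinuousFunction α ℝ) (b : BoundedContinuousFunction β ℝ),
      0 ≤ a → 0 ≤ b → (∀ z ∈ K, 1 ≤ a z.1 + b z.2) → ε ≤ ∫ x, a x ∂μ + ∫ y, b y ∂ν) :
    ∃ θ : Measure (α × β), IsFiniteMeasure θ ∧ θ K ≠ 0 ∧ θ.map Prod.fst ≤ μ ∧
      θ.map Prod.snd ≤ ν := by
  have : CompactSpace K := isCompact_iff_compactSpace.1 hK
  let S : CompactlySupportedContinuousMap K ℝ → Set ℝ := fun φ =>
    {t | ∃ (a : BoundedContinuousFunction α ℝ) (b : BoundedContinuousFunction β ℝ),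
      0 ≤ a ∧ 0 ≤ b ∧ (∀ z : K, φ z ≤ a z.1.1 + b z.1.2) ∧ t = ∫ x, a x ∂μ + ∫ y, b y ∂ν}
  have hS0 : ∀ φ, ∀ t ∈ S φ, 0 ≤ t := by
    rintro φ _ ⟨a, b, ha, hb, -, rfl⟩
    exact add_nonneg (integral_nonneg ha) (integral_nonneg hb)
  have hSb : ∀ φ, BddBelow (S φ) := fun φ => ⟨0, hS0 φ⟩
  have hSne : ∀ φ, (S φ).Nonempty := by
    intro φ
    obtain ⟨C, hC⟩ := (isCompact_range φ.continuous).bddAbove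
    refine ⟨_, BoundedContinuousFunction.const α (max C 0), 0, fun _ => le_max_right _ _, le_rfl,
      fun z => ?_, rfl⟩
    simpa using Or.inl (hC (mem_range_self z))
  have hmem : ∀ φ (a : BoundedContinuousFunction α ℝ) (b : BoundedContinuousFunction β ℝ),
      0 ≤ a → 0 ≤ b → (∀ z : K, φ z ≤ a z.1.1 + b z.1.2) →
      sInf (S φ) ≤ ∫ x, a x ∂μ + ∫ y, b y ∂ν :=
    fun φ a b ha hb hab => csInf_le (hSb φ) ⟨a, b, ha, hb, hab, rfl⟩
  have hadd : ∀ φ ψ, sInf (S (φ + ψ)) ≤ sInf (S φ) + sInf (S ψ) := by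
    intro φ ψ
    refine le_of_forall_pos_lt_add fun η hη => ?_
    obtain ⟨_, ⟨a, b, ha, hb, hab, rfl⟩, h1⟩ :=
      Real.lt_sInf_add_pos (hSne φ) (half_pos hη)
    obtain ⟨_, ⟨a', b', ha', hb', hab', rfl⟩, h2⟩ :=
      Real.lt_sInf_add_pos (hSne ψ) (half_pos hη)
    have h3 := hmem (φ + ψ) (a + a') (b + b') (add_nonneg ha ha') (add_nonneg hb hb') fun z => by
      have := hab z
      have := hab' z
      simp only [CompactlySupportedContinuousMap.coe_add, BoundedContinuousFunction.coe_add,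
        Pi.add_apply]
      linarith
    simp only [BoundedContinuousFunction.coe_add, Pi.add_apply] at h3
    rw [integral_add (a.integrable μ) (a'.integrable μ),
      integral_add (b.integrable ν) (b'.integrable ν)] at h3
    linarith
  have hsmul_le : ∀ c : ℝ, 0 < c → ∀ φ, sInf (S (c • φ)) ≤ c * sInf (S φ) := by
    intro c hc φ
    rw [← div_le_iff₀' hc]
    refine le_csInf (hSne φ) ?_
    rintro _ ⟨a, b, ha, hb, hab, rfl⟩
    rw [div_le_iff₀' hc]
    have h3 := hmem (c • φ) (c • a) (c • b) 
      (fun x => mul_nonneg hc.le (ha x)) (fun y => mul_nonneg hc.le (hb y))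
      fun z => by
        have := mul_le_mul_of_nonneg_left (hab z) hc.le
        simp only [CompactlySupportedContinuousMap.coe_smul, BoundedContinuousFunction.coe_smul,
          Pi.smul_apply, smul_eq_mul]
        linarith
    simp only [BoundedContinuousFunction.coe_smul, smul_eq_mul] at h3
    rw [integral_const_mul, integral_const_mul] at h3
    linarith
  have hsmul : ∀ c : ℝ, 0 < c → ∀ φ, sInf (S (c • φ)) = c * sInf (S φ) := by
    intro c hc φ
    refine le_antisymm (hsmul_le c hc φ) ?_
    have := hsmul_le c⁻¹ (inv_pos.2 hc) (c • φ)
    rw [inv_smul_smul₀ hc.ne'] at this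
    rwa [← div_eq_inv_mul, le_div_iff₀' hc] at this
  have hnonpos : ∀ φ, φ ≤ 0 → sInf (S φ) ≤ 0 := fun φ hφ => by
    simpa using hmem φ 0 0 le_rfl le_rfl fun z => by simpa using hφ z
  have hnonneg : ∀ φ, 0 ≤ sInf (S φ) := fun φ => Real.sInf_nonneg (hS0 φ)
  let e : CompactlySupportedContinuousMap K ℝ := ⟨1, HasCompactSupport.of_compactSpace 1⟩
  have he : ε ≤ sInf (S e) := by
    refine le_csInf (hSne e) ?_
    rintro _ ⟨a, b, ha, hb, hab, rfl⟩
    exact h a b ha hb fun z hz => hab ⟨z, hz⟩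
  have he0 : e ≠ 0 := by
    intro h0
    have := hnonpos e h0.le
    linarith
  obtain ⟨ℓ, hℓe, hℓ⟩ := exists_extension_of_le_sublinear
    (LinearPMap.mkSpanSingleton (K := ℝ) (σ := RingHom.id ℝ) e (sInf (S e)) he0)
    (fun φ => sInf (S φ)) hsmul hadd (by
      rintro ⟨x, hx⟩
      obtain ⟨c, rfl⟩ := Submodule.mem_span_singleton.1 hx
      refine (LinearPMap.mkSpanSingleton'_apply _ _ _ c _).trans_le ?_
      rcases lt_or_ge 0 c with hc | hc
      · exact (hsmul c hc e).ge
      · exact (mul_nonpos_of_nonpos_of_nonneg hc (hnonneg e)).trans (hnonneg _))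
  have hℓe' : ℓ e = sInf (S e) :=
    (hℓe ⟨e, Submodule.mem_span_singleton_self e⟩).trans
      (LinearPMap.mkSpanSingleton_apply ℝ ℝ he0 _)
  let Λ : CompactlySupportedContinuousMap K ℝ →ₚ[ℝ] ℝ := PositiveLinearMap.mk₀ ℓ fun φ hφ => by
    have := (hℓ (-φ)).trans (hnonpos (-φ) (neg_nonpos.2 hφ))
    rwa [map_neg, neg_nonpos] at this
  let ρ := RealRMK.rieszMeasure Λ
  have hρ : ∀ φ, ∫ z, φ z ∂ρ = ℓ φ := RealRMK.integral_rieszMeasure Λ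
  refine ⟨ρ.map Subtype.val, inferInstance, ?_, ?_, ?_⟩
  · rw [Measure.map_apply measurable_subtype_coe hK.measurableSet, Subtype.coe_preimage_self]
    intro h0
    have h1 := hρ e
    rw [Measure.measure_univ_eq_zero.1 h0, integral_zero_measure, hℓe'] at h1
    linarith
  · rw [Measure.map_map measurable_fst measurable_subtype_coe]
    refine measure_le_of_forall_integral_le fun a ha => ?_
    rw [integral_map (by fun_prop) a.continuous.aestronglyMeasurable]
    refine (hρ ⟨⟨fun z => a z.1.1, by fun_prop⟩, HasCompactSupport.of_compactSpace _⟩).trans_le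
      ((hℓ _).trans ?_)
    simpa using hmem _ a 0 ha le_rfl fun z => by simp
  · rw [Measure.map_map measurable_snd measurable_subtype_coe]
    refine measure_le_of_forall_integral_le fun b hb => ?_
    rw [integral_map (by fun_prop) b.continuous.aestronglyMeasurable]
    refine (hρ ⟨⟨fun z => b z.1.2, by fun_prop⟩, HasCompactSupport.of_compactSpace _⟩).trans_le
      ((hℓ _).trans ?_)
    simpa using hmem _ 0 b le_rfl hb fun z => by simp

lemma exists_boundedContinuous_cover_of_isCompact {α β : Type*} [TopologicalSpace α]
    [PolishSpace α] [MeasurableSpace α] [BorelSpace α] [TopologicalSpace β] [PolishSpace β]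
    [MeasurableSpace β] [BorelSpace β] {μ : Measure α} {ν : Measure β} [IsProbabilityMeasure μ]
    [IsProbabilityMeasure ν] {K : Set (α × β)} (hK : IsCompact K)
    (h : ∀ π : Measure (α × β), IsProbabilityMeasure π → π.map Prod.fst = μ →
      π.map Prod.snd = ν → π K = 0) {ε : ℝ} (hε : 0 < ε) :
    ∃ (a : BoundedContinuousFunction α ℝ) (b : BoundedContinuousFunction β ℝ),
      0 ≤ a ∧ 0 ≤ b ∧ (∀ z ∈ K, 1 ≤ a z.1 + b z.2) ∧ ∫ x, a x ∂μ + ∫ y, b y ∂ν < ε := by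
  by_contra! hc
  obtain ⟨θ, hθ, hθK, h₁, h₂⟩ := exists_measure_of_isCompact hK hε hc
  have hle : (2⁻¹ : ENNReal) • θ ≤ θ := by
    refine Measure.le_iff.2 fun s _ => ?_
    rw [Measure.smul_apply, smul_eq_mul]
    exact mul_le_of_le_one_left zero_le (by simp)
  have hθu : ((2⁻¹ : ENNReal) • θ) univ < 1 := by
    have h3 : θ univ ≤ 1 := by
      rw [← preimage_univ (f := Prod.fst), ← Measure.map_apply measurable_fst .univ,
        ← measure_univ (μ := μ)]
      exact h₁ univ
    calc ((2⁻¹ : ENNReal) • θ) univ ≤ 2⁻¹ * 1 := by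
          rw [Measure.smul_apply, smul_eq_mul]
          gcongr
      _ < 1 := by simp
  obtain ⟨π, hπ, hπ₁, hπ₂, hθπ⟩ := exists_coupling_ge hθu
    ((Measure.map_mono hle measurable_fst).trans h₁)
    ((Measure.map_mono hle measurable_snd).trans h₂)
  have h0 := le_antisymm ((hθπ K).trans_eq (h π hπ hπ₁ hπ₂)) zero_le
  simp [hθK] at h0

/-- **Kellerer's null set theorem**: a Borel set that is null for every coupling of `μ` and `ν` is
covered by a `μ`-null set of vertical lines and a `ν`-null set of horizontal lines. -/
theorem exists_null_cover_of_forall_coupling {α β : Type*} [TopologicalSpace α]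
    [PolishSpace α] [MeasurableSpace α] [BorelSpace α] [TopologicalSpace β] [PolishSpace β]
    [MeasurableSpace β] [BorelSpace β] {μ : Measure α} {ν : Measure β} [IsProbabilityMeasure μ]
    [IsProbabilityMeasure ν] {U : Set (α × β)} (hU : MeasurableSet U)
    (h : ∀ π : Measure (α × β), IsProbabilityMeasure π → π.map Prod.fst = μ →
      π.map Prod.snd = ν → π U = 0) :
    ∃ N₁ N₂, MeasurableSet N₁ ∧ MeasurableSet N₂ ∧ μ N₁ = 0 ∧ ν N₂ = 0 ∧
      U ⊆ N₁ ×ˢ univ ∪ univ ×ˢ N₂ := by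
  let lam : Measure (α ⊕ β) := μ.map Sum.inl + ν.map Sum.inr
  have hlam : ∀ A, MeasurableSet A → lam A = μ (Sum.inl ⁻¹' A) + ν (Sum.inr ⁻¹' A) := by
    intro A hA
    rw [Measure.add_apply, Measure.map_apply measurable_inl hA, Measure.map_apply measurable_inr hA]
  have hsmall : ∀ r : ℝ, 0 < r → ∃ f ∈ marginalCover lam U, ‖f‖ ≤ r := by
    intro r hr
    refine choquet_capacitability (P := fun U => ∃ f ∈ marginalCover lam U, ‖f‖ ≤ r)
      (fun s t hst ⟨f, hf, hfr⟩ => ⟨f, marginalCover_anti hst hf, hfr⟩) ?_ hU.analyticSet ?_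
    · intro s hs hP
      obtain ⟨f, hf, hfr⟩ := exists_mem_iInter_norm_le
        (fun n => isClosed_marginalCover (lam := lam) (s n)) (fun n => convex_marginalCover (s n))
        (fun n m hnm => marginalCover_anti (hs hnm)) hP
      exact ⟨f, iInter_marginalCover_subset s hf, hfr⟩
    · intro K hKU hK
      obtain ⟨a, b, ha, hb, hab, hlt⟩ := exists_boundedContinuous_cover_of_isCompact hK
        (fun π h1 h2 h3 => measure_mono_null hKU (h π h1 h2 h3))
        (ε := 1 / 4 * r ^ 2) (by positivity)
      refine ⟨{z | 1 / 4 < a z.1} ∪ {z | 1 / 4 < b z.2}, ?_, ?_, ?_⟩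
      · exact (isOpen_lt (by fun_prop) (by fun_prop)).union (isOpen_lt (by fun_prop) (by fun_prop))
      · intro z hz
        have h1 := hab z hz
        by_contra! hc
        simp only [mem_union, mem_ofPred_eq, not_or, not_lt] at hc
        linarith
      · have hA : MeasurableSet {z : α ⊕ β | 1 / 4 < Sum.elim a b z} :=
          measurableSet_lt measurable_const
            (a.continuous.measurable.sumElim b.continuous.measurable)
        refine exists_mem_marginalCover_of_subset hA hr.le ?_ fun x y hxy => hxy
        have h1 : 1 / 4 * μ.real {x | 1 / 4 ≤ a x} ≤ ∫ x, a x ∂μ :=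
          mul_meas_ge_le_integral_of_nonneg (.of_forall ha) (a.integrable μ) (1 / 4)
        have h2 : 1 / 4 * ν.real {y | 1 / 4 ≤ b y} ≤ ∫ y, b y ∂ν :=
          mul_meas_ge_le_integral_of_nonneg (.of_forall hb) (b.integrable ν) (1 / 4)
        rw [hlam _ hA]
        calc μ {x | 1 / 4 < a x} + ν {y | 1 / 4 < b y}
            ≤ μ {x | 1 / 4 ≤ a x} + ν {y | 1 / 4 ≤ b y} := by
              gcongr <;> exact fun h => h.le
          _ = ENNReal.ofReal (μ.real {x | 1 / 4 ≤ a x} + ν.real {y | 1 / 4 ≤ b y}) := by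
              rw [ENNReal.ofReal_add measureReal_nonneg measureReal_nonneg, ofReal_measureReal,
                ofReal_measureReal]
          _ ≤ ENNReal.ofReal (r ^ 2) := ENNReal.ofReal_le_ofReal (by linarith)
  have h0 : (0 : Lp ℝ 2 lam) ∈ marginalCover lam U := by
    rw [← (isClosed_marginalCover U).closure_eq, Metric.mem_closure_iff]
    intro ε hε
    obtain ⟨f, hf, hfr⟩ := hsmall (ε / 2) (half_pos hε)
    exact ⟨f, hf, by rw [dist_zero_left]; linarith⟩
  obtain ⟨N, hN, hN0, hNU⟩ := exists_null_of_zero_mem_marginalCover h0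
  rw [hlam N hN, add_eq_zero] at hN0
  refine ⟨_, _, measurable_inl hN, measurable_inr hN, hN0.1, hN0.2, fun z hz => ?_⟩
  simpa using hNU z.1 z.2 hz

end NullSets

lemma integrable_mul_and_abs_integral_le {X : Type*} [MeasurableSpace X] {ρ : Measure X}
    [IsProbabilityMeasure ρ] {k f q : X → ℝ} {H c : ℝ} (hk : Measurable k) (hf : Measurable f)
    (hk0 : ∀ x, 0 ≤ k x) (hkH : ∀ x, k x ≤ H) (hfc : ∀ x, |f x| ≤ c * (q x + 1))
    (hq : Integrable q ρ) :
    Integrable (fun x => k x * f x) ρ ∧ |∫ x, k x * f x ∂ρ| ≤ H * c * (∫ x, q x ∂ρ + 1) := by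
  have hint : Integrable (fun x => H * c * (q x + 1)) ρ :=
    (hq.add (integrable_const 1)).const_mul _
  have hle : ∀ x, ‖k x * f x‖ ≤ H * c * (q x + 1) := by
    intro x
    rw [norm_mul, Real.norm_of_nonneg (hk0 x), Real.norm_eq_abs, mul_assoc]
    exact mul_le_mul (hkH x) (hfc x) (abs_nonneg _) ((hk0 x).trans (hkH x))
  refine ⟨hint.mono' (hk.mul hf).aestronglyMeasurable (.of_forall hle), ?_⟩
  refine (norm_integral_le_of_norm_le hint (.of_forall hle)).trans_eq ?_
  rw [integral_const_mul, integral_add hq (integrable_const 1), integral_const]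
  simp

/-- if the set of `𝓕`-transports between `μ` and `ν` is nonempty and `δ > 0`,
then a Borel set `U ⊆ Ω × Ω` is polar for all `δ`-approximating `𝓕`-transports if and only if
it is contained in `(N₁ × Ω) ∪ (Ω × N₂)` for Borel sets `N₁, N₂` with `μ(N₁) = 0`,
`ν(N₂) = 0`. -/
theorem stmt_9 {Ω : Type*} [TopologicalSpace Ω] [PolishSpace Ω]
    [MeasurableSpace Ω] [BorelSpace Ω]
    (p : Ω → ℝ) (hpm : Measurable p) (hp0 : ∀ ω, 0 ≤ p ω)
    (G : Set (Ω → ℝ)) (hGmeas : ∀ g ∈ G, Measurable g)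
    (hGnorm : ∀ g ∈ G, BddAbove (Set.range fun ω => |g ω| / (p ω + 1)))
    (μ ν : Measure Ω) [IsProbabilityMeasure μ] [IsProbabilityMeasure ν]
    (hpμ : Integrable p μ) (hpν : Integrable p ν)
    (δ : ℝ) (hδ : 0 < δ)
    (hex : ∃ π₀ : Measure (Ω × Ω), IsProbabilityMeasure π₀ ∧
      π₀.map Prod.fst = μ ∧ π₀.map Prod.snd = ν ∧
      ∀ g ∈ G, ∀ h : Ω → ℝ, Measurable h → (∀ ω, 0 ≤ h ω) →
        (∃ M : ℝ, ∀ ω, h ω ≤ M) →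
        ∫ ω, h ω * g ω ∂μ ≤ ∫ x : Ω × Ω, h x.1 * g x.2 ∂π₀) :
    ∀ U : Set (Ω × Ω), MeasurableSet U →
      ((∀ π : Measure (Ω × Ω), IsProbabilityMeasure π →
          π.map Prod.fst = μ → π.map Prod.snd = ν →
          (∀ g ∈ G, ∀ h : Ω → ℝ, Measurable h → (∀ ω, 0 ≤ h ω) →
            (∃ M : ℝ, ∀ ω, h ω ≤ M) →
            (∫ ω, h ω * g ω ∂μ) - (∫ x : Ω × Ω, h x.1 * g x.2 ∂π)
              ≤ δ * (⨆ ω : Ω, h ω) * pNorm p g) →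
          π U = 0) ↔
        (∃ N₁ N₂ : Set Ω, MeasurableSet N₁ ∧ MeasurableSet N₂ ∧
          μ N₁ = 0 ∧ ν N₂ = 0 ∧
          U ⊆ (N₁ ×ˢ (Set.univ : Set Ω)) ∪ ((Set.univ : Set Ω) ×ˢ N₂))) := by
  intro U hU
  constructor
  · intro hpolar
    refine exists_null_cover_of_forall_coupling hU fun π hπ hπ₁ hπ₂ => ?_
    obtain ⟨π₀, hπ₀, hπ₀₁, hπ₀₂, htr⟩ := hex
    set C := (∫ ω, p ω ∂μ + 1) + (∫ ω, p ω ∂ν + 1) with hC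
    have hC0 : 0 < C := by
      have h1 : 0 ≤ ∫ ω, p ω ∂μ := integral_nonneg hp0
      have h2 : 0 ≤ ∫ ω, p ω ∂ν := integral_nonneg hp0
      positivity
    set t := δ / (C + δ) with ht
    have ht0 : 0 < t := by positivity
    have ht1 : t ≤ 1 := by
      rw [ht, div_le_one (by positivity)]
      linarith
    have htC : t * C ≤ δ := by
      rw [ht, div_mul_eq_mul_div, div_le_iff₀ (by positivity)]
      nlinarith
    have hsum : ENNReal.ofReal (1 - t) + ENNReal.ofReal t = 1 := by
      rw [← ENNReal.ofReal_add (by linarith) ht0.le]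
      simp
    have key := hpolar (ENNReal.ofReal (1 - t) • π₀ + ENNReal.ofReal t • π) ⟨by simp [hsum]⟩
      (by rw [Measure.map_add _ _ measurable_fst, Measure.map_smul, Measure.map_smul, hπ₁, hπ₀₁,
            ← add_smul, hsum, one_smul])
      (by rw [Measure.map_add _ _ measurable_snd, Measure.map_smul, Measure.map_smul, hπ₂, hπ₀₂,
            ← add_smul, hsum, one_smul]) ?_
    · rw [Measure.add_apply, Measure.smul_apply, Measure.smul_apply, add_eq_zero, smul_eq_mul,
        smul_eq_mul, mul_eq_zero, mul_eq_zero] at key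
      exact key.2.resolve_left (ENNReal.ofReal_pos.2 ht0).ne'
    · intro g hg h hh hh0 ⟨M, hM⟩
      have hhH : ∀ ω, h ω ≤ ⨆ ω, h ω :=
        le_ciSup (f := h) ⟨M, by rintro _ ⟨ω, rfl⟩; exact hM ω⟩
      have hH0 : 0 ≤ ⨆ ω, h ω := Real.iSup_nonneg hh0
      have hg0 : 0 ≤ pNorm p g :=
        Real.iSup_nonneg fun ω => div_nonneg (abs_nonneg _) (by linarith [hp0 ω])
      have hgp : ∀ ω, |g ω| ≤ pNorm p g * (p ω + 1) := fun ω => by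
        rw [← div_le_iff₀ (by linarith [hp0 ω])]
        exact le_ciSup (hGnorm g hg) ω
      have hcoup : ∀ ρ : Measure (Ω × Ω), IsProbabilityMeasure ρ → ρ.map Prod.snd = ν →
          Integrable (fun x : Ω × Ω => h x.1 * g x.2) ρ ∧
          |∫ x : Ω × Ω, h x.1 * g x.2 ∂ρ| ≤ (⨆ ω, h ω) * pNorm p g * (∫ ω, p ω ∂ν + 1) := by
        rintro ρ hρ rfl
        rw [integral_map measurable_snd.aemeasurable hpm.aestronglyMeasurable]
        exact integrable_mul_and_abs_integral_le (hh.comp measurable_fst)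
          ((hGmeas g hg).comp measurable_snd) (fun x => hh0 _) (fun x => hhH _) (fun x => hgp _)
          (hpν.comp_measurable measurable_snd)
      have hI := (integrable_mul_and_abs_integral_le hh (hGmeas g hg) hh0 hhH hgp hpμ).2
      obtain ⟨hi₀, -⟩ := hcoup π₀ hπ₀ hπ₀₂
      obtain ⟨hi, hJ⟩ := hcoup π hπ hπ₂
      have hJ₀ := htr g hg h hh hh0 ⟨M, hM⟩
      rw [integral_add_measure (hi₀.smul_measure ENNReal.ofReal_ne_top)
        (hi.smul_measure ENNReal.ofReal_ne_top), integral_smul_measure, integral_smul_measure,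
        ENNReal.toReal_ofReal (by linarith), ENNReal.toReal_ofReal ht0.le, smul_eq_mul, smul_eq_mul]
      set I := ∫ ω, h ω * g ω ∂μ
      set J₀ := ∫ x : Ω × Ω, h x.1 * g x.2 ∂π₀
      set J := ∫ x : Ω × Ω, h x.1 * g x.2 ∂π
      calc I - ((1 - t) * J₀ + t * J) ≤ t * (I - J) := by nlinarith
        _ ≤ t * ((⨆ ω, h ω) * pNorm p g * C) := by
            gcongr
            rw [hC, mul_add]
            linarith [le_abs_self I, neg_abs_le J]
        _ = t * C * ((⨆ ω, h ω) * pNorm p g) := by ring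
        _ ≤ δ * ((⨆ ω, h ω) * pNorm p g) := by gcongr
        _ = δ * (⨆ ω, h ω) * pNorm p g := by ring
  · rintro ⟨N₁, N₂, hN₁, hN₂, hμ, hν, hUN⟩ π - hπ₁ hπ₂ -
    rw [← hπ₁, Measure.map_apply measurable_fst hN₁] at hμ
    rw [← hπ₂, Measure.map_apply measurable_snd hN₂] at hν
    refine measure_mono_null hUN (measure_union_null ?_ ?_)
    · rwa [Set.prod_univ]
    · rwa [Set.univ_prod]
end

section
/- Let (Ω, d) be a metric space and let v, u₁, u₂ : Ω → ℝ be 1-Lipschitz functions. Suppose there exist λ₁ > 0 and λ₂ > 0 such that λ₁·(v − u₁) = −λ₂·(v − u₂) pointwise on Ω. Then for all ω₁, ω₂ ∈ Ω with |v(ω₁) − v(ω₂)| = d(ω₁, ω₂) one has u₁(ω₁) − u₁(ω₂) = v(ω₁) − v(ω₂); in particular, the function v − u₁ is constant on every transport ray of v. -/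
/-- A transport ray of a 1-Lipschitz function `v` on a metric space: a maximal set on which
`v` is an isometry. -/
def IsTransportRay {Ω : Type*} [MetricSpace Ω] (v : Ω → ℝ) (T : Set Ω) : Prop :=
  (∀ x ∈ T, ∀ y ∈ T, |v x - v y| = dist x y) ∧
  ∀ T' : Set Ω, T ⊆ T' → (∀ x ∈ T', ∀ y ∈ T', |v x - v y| = dist x y) → T' = T

/-- If `l₁·(v - u₁) = -l₂·(v - u₂)` pointwise for 1-Lipschitz `v, u₁, u₂` and
positive `l₁, l₂`, then `u₁` moves exactly as `v` along any pair of points where `v` attains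
the metric; in particular `v - u₁` is constant on every transport ray of `v`. -/
theorem stmt_12 {Ω : Type*} [MetricSpace Ω] (v u₁ u₂ : Ω → ℝ)
    (hv : LipschitzWith 1 v) (hu₁ : LipschitzWith 1 u₁) (hu₂ : LipschitzWith 1 u₂)
    (l₁ l₂ : ℝ) (hl₁ : 0 < l₁) (hl₂ : 0 < l₂)
    (heq : ∀ ω : Ω, l₁ * (v ω - u₁ ω) = -(l₂ * (v ω - u₂ ω))) :
    (∀ ω₁ ω₂ : Ω, |v ω₁ - v ω₂| = dist ω₁ ω₂ → u₁ ω₁ - u₁ ω₂ = v ω₁ - v ω₂) ∧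
    ∀ T : Set Ω, IsTransportRay v T → ∀ x ∈ T, ∀ y ∈ T,
      v x - u₁ x = v y - u₁ y := by
  have key : ∀ x y : Ω, |v x - v y| = dist x y → u₁ x - u₁ y = v x - v y := by
    intro x y h
    have h₁ : |u₁ x - u₁ y| ≤ dist x y := by
      simpa [Real.dist_eq] using hu₁.dist_le_mul x y
    have h₂ : |u₂ x - u₂ y| ≤ dist x y := by
      simpa [Real.dist_eq] using hu₂.dist_le_mul x y
    obtain ⟨h₁l, h₁r⟩ := abs_le.mp h₁
    obtain ⟨h₂l, h₂r⟩ := abs_le.mp h₂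
    have hsum : l₁ * ((v x - v y) - (u₁ x - u₁ y)) +
        l₂ * ((v x - v y) - (u₂ x - u₂ y)) = 0 := by
      linear_combination heq x - heq y
    rcases abs_choice (v x - v y) with ha | ha <;> rw [ha] at h
    · apply le_antisymm
      · linarith
      · by_contra! hlt
        have hpos := mul_pos hl₁ (sub_pos.mpr hlt)
        have hnonneg : 0 ≤ l₂ * ((v x - v y) - (u₂ x - u₂ y)) :=
          mul_nonneg hl₂.le (by linarith)
        linarith
    · apply le_antisymm
      · by_contra! hlt
        have hneg := mul_neg_of_pos_of_neg hl₁ (sub_neg.mpr hlt)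
        have hnonpos : l₂ * ((v x - v y) - (u₂ x - u₂ y)) ≤ 0 :=
          mul_nonpos_of_nonneg_of_nonpos hl₂.le (by linarith)
        linarith
      · linarith
  refine ⟨key, fun T hT x hx y hy => ?_⟩
  linarith [key x y (hT.1 x hx y hy)]
end

section
/- Let (Ω, d) be a metric space, let v : Ω → ℝ be 1-Lipschitz, let K ⊆ Ω, and let δ > 0. Define K_δ = {ω ∈ Ω : δ ≤ d(ω, ω') − |v(ω) − v(ω')| for all ω' ∈ K}. Then K ∩ K_δ = ∅ whenever K is nonempty, and the function w : K ∪ K_δ → ℝ defined by w(ω) = v(ω) − δ for ω ∈ K and w(ω) = v(ω) for ω ∈ K_δ is 1-Lipschitz on K ∪ K_δ, i.e. |w(ω₁) − w(ω₂)| ≤ d(ω₁, ω₂) for all ω₁, ω₂ ∈ K ∪ K_δ. Moreover |w(ω) − v(ω)| ≤ δ for all ω ∈ K ∪ K_δ. -/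
/-- The set `K_δ` of points whose distance to every point of `K` exceeds the variation of `v`
by at least `δ`. -/
def Kdelta {Ω : Type*} [MetricSpace Ω] (v : Ω → ℝ) (K : Set Ω) (δ : ℝ) : Set Ω :=
  {ω | ∀ ω' ∈ K, δ ≤ dist ω ω' - |v ω - v ω'|}

open Classical in
/-- The function equal to `v - δ` on `K` and to `v` elsewhere (in particular on `K_δ`). -/
noncomputable def wFun {Ω : Type*} [MetricSpace Ω] (v : Ω → ℝ) (K : Set Ω) (δ : ℝ)
    (ω : Ω) : ℝ :=
  if ω ∈ K then v ω - δ else v ω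

/-- For a 1-Lipschitz `v`, a set `K` and `δ > 0`: `K` and `K_δ` are disjoint
(when `K` is nonempty), the function `w` equal to `v - δ` on `K` and to `v` on `K_δ` is
1-Lipschitz on `K ∪ K_δ`, and `w` is within `δ` of `v` on `K ∪ K_δ`. -/
theorem stmt_13 {Ω : Type*} [MetricSpace Ω] (v : Ω → ℝ) (hv : LipschitzWith 1 v)
    (K : Set Ω) (δ : ℝ) (hδ : 0 < δ) :
    (K.Nonempty → K ∩ Kdelta v K δ = ∅) ∧
    (∀ ω₁ ∈ K ∪ Kdelta v K δ, ∀ ω₂ ∈ K ∪ Kdelta v K δ,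
      |wFun v K δ ω₁ - wFun v K δ ω₂| ≤ dist ω₁ ω₂) ∧
    (∀ ω ∈ K ∪ Kdelta v K δ, |wFun v K δ ω - v ω| ≤ δ) := by
  have hK : ∀ ω ∈ K, wFun v K δ ω = v ω - δ := fun ω h => if_pos h
  have hK' : ∀ ω ∉ K, wFun v K δ ω = v ω := fun ω h => if_neg h
  have hd : ∀ x y, |v x - v y| ≤ dist x y := fun x y => by
    simpa [Real.dist_eq] using hv.dist_le_mul x y
  have mixed : ∀ x ∈ K, ∀ y ∈ Kdelta v K δ, |v x - δ - v y| ≤ dist x y := by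
    intro x hx y hy
    have h := hy x hx
    rw [dist_comm, abs_sub_comm] at h
    have := abs_le.mp (show |v x - v y| ≤ dist x y - δ by linarith)
    exact abs_le.mpr ⟨by linarith, by linarith⟩
  refine ⟨fun _ => ?_, fun x hx y hy => ?_, fun x _ => ?_⟩
  · ext x
    simp only [Set.mem_inter_iff, Set.mem_empty_iff_false, iff_false, not_and]
    intro hx hx'
    have := hx' x hx
    simp only [dist_self, sub_self, abs_zero] at this
    linarith
  · by_cases h₁ : x ∈ K <;> by_cases h₂ : y ∈ K
    · rw [hK x h₁, hK y h₂, sub_sub_sub_cancel_right]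
      exact hd x y
    · rw [hK x h₁, hK' y h₂]
      exact mixed x h₁ y (hy.resolve_left h₂)
    · rw [hK' x h₁, hK y h₂, abs_sub_comm, dist_comm]
      exact mixed y h₂ x (hx.resolve_left h₁)
    · rw [hK' x h₁, hK' y h₂]
      exact hd x y
  · by_cases h : x ∈ K
    · rw [hK x h, sub_sub_cancel_left, abs_neg, abs_of_pos hδ]
    · rw [hK' x h, sub_self, abs_zero]
      exact hδ.le
end
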